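/- Let α ∈ (0,1) be irrational and X_α the one-sided Sturmian subshift with branch point ω_α. Then: (1) for every k ∈ ℕ, the point σ_α^k(ω_α) is isolated in (k+1)-past equivalence, and its (k+1)-past is P_{k+1}(σ_α^k(ω_α)) = {0·(ω_α)_{[0,k)}, 1·(ω_α)_{[0,k)}}; (2) a point x ∈ X_α is isolated in l-past equivalence for some l ∈ ℕ if and only if x ∈ orb⁺_α(ω_α) = {σ_α^k(ω_α) : k ∈ ℕ}; (3) x ∈ X_α has a unique past if and only if x ∉ orb⁺_α(ω_α). -/

import Mathlib

noncomputable section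

open Set

/-! ### Sturmian sequences and subshifts -/

/-- The Sturmian coding of a real number `t`: `false` (the symbol `0`) if the fractional
part of `t` lies in `[0, 1 - α)`, and `true` (the symbol `1`) if it lies in `[1 - α, 1)`. -/
def sturmianCode (α t : ℝ) : Bool := decide (1 - α ≤ Int.fract t)

/-- The one-sided Sturmian sequence with parameter `α` and starting point `t`,
i.e. `i ↦ I_α (R_α^i t)`. -/
def sturmianSeqN (α t : ℝ) : ℕ → Bool := fun i => sturmianCode α (t + i * α)

/-- The one-sided Sturmian subshift `X_α`. -/
def sturmianN (α : ℝ) : Set (ℕ → Bool) := closure {x | ∃ t : ℝ, x = sturmianSeqN α t}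

/-- The two-sided Sturmian sequence with parameter `α` and starting point `t`. -/
def sturmianSeqZ (α t : ℝ) : ℤ → Bool := fun i => sturmianCode α (t + i * α)

/-- The two-sided Sturmian subshift `Λ_α`. -/
def sturmianZ (α : ℝ) : Set (ℤ → Bool) := closure {x | ∃ t : ℝ, x = sturmianSeqZ α t}

/-- The shift on one-sided sequences. -/
def shiftN {A : Type*} (x : ℕ → A) : ℕ → A := fun i => x (i + 1)

/-- The shift on two-sided sequences. -/
def shiftZ {A : Type*} (x : ℤ → A) : ℤ → A := fun i => x (i + 1)

lemma continuous_shiftN {A : Type*} [TopologicalSpace A] :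
    Continuous (shiftN (A := A)) := continuous_pi fun i => continuous_apply (i + 1)

lemma continuous_shiftZ {A : Type*} [TopologicalSpace A] :
    Continuous (shiftZ (A := A)) := continuous_pi fun i => continuous_apply (i + 1)

lemma sturmianN_shift_mem {α : ℝ} {x : ℕ → Bool} (hx : x ∈ sturmianN α) :
    shiftN x ∈ sturmianN α := by
  have h : MapsTo shiftN {x : ℕ → Bool | ∃ t : ℝ, x = sturmianSeqN α t}
      {x : ℕ → Bool | ∃ t : ℝ, x = sturmianSeqN α t} := by
    rintro x ⟨t, rfl⟩
    refine ⟨t + α, ?_⟩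
    funext i
    show sturmianCode α (t + (↑(i + 1) : ℝ) * α) = sturmianCode α (t + α + (i : ℝ) * α)
    congr 1
    push_cast
    ring
  exact h.closure continuous_shiftN hx

lemma sturmianZ_shift_mem {α : ℝ} {x : ℤ → Bool} (hx : x ∈ sturmianZ α) :
    shiftZ x ∈ sturmianZ α := by
  have h : MapsTo shiftZ {x : ℤ → Bool | ∃ t : ℝ, x = sturmianSeqZ α t}
      {x : ℤ → Bool | ∃ t : ℝ, x = sturmianSeqZ α t} := by
    rintro x ⟨t, rfl⟩
    refine ⟨t + α, ?_⟩
    funext i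
    show sturmianCode α (t + (↑(i + 1) : ℝ) * α) = sturmianCode α (t + α + (i : ℝ) * α)
    congr 1
    push_cast
    ring
  exact h.closure continuous_shiftZ hx

/-- The shift map `σ_α : X_α → X_α` of the one-sided Sturmian subshift. -/
def sturmianShiftN (α : ℝ) (x : ↥(sturmianN α)) : ↥(sturmianN α) :=
  ⟨shiftN x.1, sturmianN_shift_mem x.2⟩

/-- The shift map `σ_α : Λ_α → Λ_α` of the two-sided Sturmian subshift. -/
def sturmianShiftZ (α : ℝ) (x : ↥(sturmianZ α)) : ↥(sturmianZ α) :=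
  ⟨shiftZ x.1, sturmianZ_shift_mem x.2⟩

/-- The branch point `ω_α` of the one-sided Sturmian subshift (corresponding to `t = α`). -/
def sturmianBranch (α : ℝ) : ℕ → Bool := sturmianSeqN α α

/-- The orbit `orb_α(x) = ⋃_{k,l} σ_α^{-l}(σ_α^k(x))` of a point of `X_α`. -/
def sturmianOrbN (α : ℝ) (x : ℕ → Bool) : Set (ℕ → Bool) :=
  {y | y ∈ sturmianN α ∧ ∃ k l : ℕ, shiftN^[l] y = shiftN^[k] x}

/-- The forward orbit `orb⁺_α(x) = {σ_α^k(x) : k ∈ ℕ}`. -/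
def sturmianOrbPlus (α : ℝ) (x : ℕ → Bool) : Set (ℕ → Bool) :=
  {y | ∃ k : ℕ, y = shiftN^[k] x}

/-- The orbit `{σ^n(x) : n ∈ ℤ}` of a two-sided sequence under the shift:
`σ^n(x) = (i ↦ x (i + n))`. -/
def orbitZ {A : Type*} (x : ℤ → A) : Set (ℤ → A) := {y | ∃ n : ℤ, y = fun i => x (i + n)}

/-- Equivalence of irrationals: `α ∼ β` iff `β = (aα+b)/(cα+d)` with `ad - bc = ±1`. -/
def IrrationalEquiv (α β : ℝ) : Prop :=
  ∃ a b c d : ℤ, (a * d - b * c = 1 ∨ a * d - b * c = -1) ∧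
    β = ((a : ℝ) * α + b) / ((c : ℝ) * α + d)

/-- The subgroup `ℤ + αℤ = {m + nα : m, n ∈ ℤ}` of `ℝ`, as an ordered abelian group with
the order inherited from `ℝ`. -/
def ZplusAZ (α : ℝ) : AddSubgroup ℝ where
  carrier := {x | ∃ m n : ℤ, x = (m : ℝ) + n * α}
  add_mem' := by
    rintro x y ⟨m, n, rfl⟩ ⟨m', n', rfl⟩
    exact ⟨m + m', n + n', by push_cast; ring⟩
  zero_mem' := ⟨0, 0, by norm_num⟩
  neg_mem' := by
    rintro x ⟨m, n, rfl⟩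
    exact ⟨-m, -n, by push_cast; ring⟩

lemma one_mem_ZplusAZ (α : ℝ) : (1 : ℝ) ∈ ZplusAZ α := ⟨1, 0, by norm_num⟩

/-! ### Suspension and flow -/

/-- The relation `(x, s+1) ∼ (σ_α x, s)` generating the suspension of `(Λ_α, σ_α)`. -/
def suspRel (α : ℝ) (p q : ↥(sturmianZ α) × ℝ) : Prop :=
  ∃ (x : ↥(sturmianZ α)) (s : ℝ), p = (x, s + 1) ∧ q = (sturmianShiftZ α x, s)

/-- The suspension (mapping torus) of the two-sided Sturmian subshift `(Λ_α, σ_α)`: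
the quotient of `Λ_α × ℝ` by the equivalence relation generated by `(x,s+1) ∼ (σ_α x, s)`. -/
def Suspension (α : ℝ) : Type := Quot (suspRel α)

instance (α : ℝ) : TopologicalSpace (Suspension α) := by
  unfold Suspension; infer_instance

/-- The flow `φ_{s'}[x,s] = [x, s + s']` on the suspension. -/
def suspFlow (α : ℝ) (s' : ℝ) : Suspension α → Suspension α :=
  Quot.map (fun p => (p.1, p.2 + s'))
    (by
      rintro p q ⟨x, s, rfl, rfl⟩
      exact ⟨x, s + s', by show (x, s + 1 + s') = (x, s + s' + 1); rw [add_right_comm s 1 s'], rfl⟩)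

/-- Flow equivalence of two Sturmian subshifts: a homeomorphism of the suspensions mapping
each flow orbit onto a flow orbit, preserving the forward direction of the flow. -/
def SturmianFlowEquiv (α β : ℝ) : Prop :=
  ∃ h : Suspension α ≃ₜ Suspension β, ∀ u : Suspension α, ∃ c : ℝ → ℝ,
    StrictMono c ∧ Function.Surjective c ∧
      ∀ s : ℝ, h (suspFlow α s u) = suspFlow β (c s) (h u)

/-! ### Words and pasts -/

/-- Prepend a letter to a one-sided sequence. -/
def consSeq {A : Type*} (a : A) (x : ℕ → A) : ℕ → A := fun i => if i = 0 then a else x (i - 1)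

/-- Prepend a finite word (a list) to a one-sided sequence: `μx`. -/
def wordCat {A : Type*} (μ : List A) (x : ℕ → A) : ℕ → A := μ.foldr consSeq x

/-- The set `P_l(x)` of `l`-pasts of `x` relative to a subshift `X`. -/
def past {A : Type*} (X : Set (ℕ → A)) (l : ℕ) (x : ℕ → A) : Set (List A) :=
  {μ | μ.length = l ∧ wordCat μ x ∈ X}

/-- `x` is isolated in `l`-past equivalence in `X`. -/
def IsolatedInPast {A : Type*} (X : Set (ℕ → A)) (l : ℕ) (x : ℕ → A) : Prop :=
  ∀ y ∈ X, past X l y = past X l x → y = x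


lemma shiftN_consSeq {A : Type*} (a : A) (x : ℕ → A) : shiftN (consSeq a x) = x := by
  funext i; simp [shiftN, consSeq]

lemma consSeq_shiftN {A : Type*} (x : ℕ → A) : consSeq (x 0) (shiftN x) = x := by
  funext i; cases i <;> simp [consSeq, shiftN]

lemma shiftN_iterate_apply {A : Type*} (x : ℕ → A) (k i : ℕ) : shiftN^[k] x i = x (i + k) := by
  induction k generalizing x i with
  | zero => rfl
  | succ k ih =>
    rw [Function.iterate_succ_apply, ih (shiftN x) i]
    show x (i + k + 1) = x (i + (k + 1))
    ring_nf

lemma shiftN_iterate_wordCat {A : Type*} (μ : List A) (x : ℕ → A) :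
    shiftN^[μ.length] (wordCat μ x) = x := by
  induction μ with
  | nil => rfl
  | cons a μ ih =>
    show shiftN^[μ.length + 1] (consSeq a (wordCat μ x)) = x
    rw [Function.iterate_succ_apply, shiftN_consSeq, ih]

lemma wordCat_append {A : Type*} (μ ν : List A) (x : ℕ → A) :
    wordCat (μ ++ ν) x = wordCat μ (wordCat ν x) := by
  simp [wordCat, List.foldr_append]

lemma shiftN_mem_of_image {A : Type*} {X : Set (ℕ → A)} (hX : shiftN '' X = X)
    {x : ℕ → A} (hx : x ∈ X) : shiftN x ∈ X := by
  rw [← hX]; exact ⟨x, hx, rfl⟩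

lemma shiftN_iterate_mem_of_image {A : Type*} {X : Set (ℕ → A)} (hX : shiftN '' X = X)
    {x : ℕ → A} (hx : x ∈ X) (k : ℕ) : shiftN^[k] x ∈ X := by
  induction k generalizing x with
  | zero => exact hx
  | succ k ih =>
    rw [Function.iterate_succ_apply]
    exact ih (shiftN_mem_of_image hX hx)

lemma exists_word_extension {A : Type*} {X : Set (ℕ → A)} (hX : shiftN '' X = X)
    {z : ℕ → A} (hz : z ∈ X) (d : ℕ) : ∃ ν : List A, ν.length = d ∧ wordCat ν z ∈ X := by
  induction d with
  | zero => exact ⟨[], rfl, hz⟩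
  | succ d ih =>
    obtain ⟨ν, hlen, hν⟩ := ih
    have : wordCat ν z ∈ shiftN '' X := by rw [hX]; exact hν
    obtain ⟨w, hw, hweq⟩ := this
    refine ⟨w 0 :: ν, by simp [hlen], ?_⟩
    show consSeq (w 0) (wordCat ν z) ∈ X
    rw [← hweq, consSeq_shiftN]
    exact hw

lemma past_mono {A : Type*} {X : Set (ℕ → A)} (hX : shiftN '' X = X) {m l : ℕ} (hml : m ≤ l)
    {z z' : ℕ → A} (h : past X l z = past X l z') : past X m z = past X m z' := by
  have key : ∀ w w' : ℕ → A, past X l w ⊆ past X l w' → past X m w ⊆ past X m w' := by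
    intro w w' hsub μ hμ
    obtain ⟨hlen, hmem⟩ := hμ
    obtain ⟨ν, hνlen, hνmem⟩ := exists_word_extension hX hmem (l - m)
    rw [← wordCat_append] at hνmem
    have hin : ν ++ μ ∈ past X l w := ⟨by simp [hνlen, hlen]; omega, hνmem⟩
    have hout := hsub hin
    obtain ⟨-, hmem'⟩ := hout
    rw [wordCat_append] at hmem'
    have := shiftN_iterate_mem_of_image hX hmem' ν.length
    rw [shiftN_iterate_wordCat] at this
    exact ⟨hlen, this⟩
  exact subset_antisymm (key z z' h.subset) (key z' z h.symm.subset)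

/-- prefix word of length `d` -/
def prefixWord {A : Type*} (x : ℕ → A) (d : ℕ) : List A := (List.range d).map x

lemma wordCat_prefixWord {A : Type*} (x : ℕ → A) (d : ℕ) :
    wordCat (prefixWord x d) (shiftN^[d] x) = x := by
  induction d generalizing x with
  | zero => rfl
  | succ d ih =>
    have h1 : prefixWord x (d + 1) = x 0 :: prefixWord (shiftN x) d := by
      show (List.range (d+1)).map x = _
      rw [List.range_succ_eq_map, List.map_cons, List.map_map]
      rfl
    rw [h1, Function.iterate_succ_apply]
    show consSeq (x 0) (wordCat (prefixWord (shiftN x) d) (shiftN^[d] (shiftN x))) = x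
    rw [ih (shiftN x), consSeq_shiftN]

lemma prefixWord_length {A : Type*} (x : ℕ → A) (d : ℕ) : (prefixWord x d).length = d := by
  simp [prefixWord]

lemma past_wordCat {A : Type*} {X : Set (ℕ → A)} (τ : List A) (z : ℕ → A) (m : ℕ) (μ : List A) :
    μ ∈ past X m (wordCat τ z) ↔ μ ++ τ ∈ past X (m + τ.length) z := by
  constructor
  · rintro ⟨hlen, hmem⟩
    exact ⟨by simp [hlen], by rwa [wordCat_append]⟩
  · rintro ⟨hlen, hmem⟩
    rw [wordCat_append] at hmem
    refine ⟨?_, hmem⟩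
    simp at hlen; omega

/-- Monotonicity of `∼_{k,l}` under the order `⪯`. -/
lemma sim_mono {A : Type*} {X : Set (ℕ → A)} (hX : shiftN '' X = X)
    {k₁ l₁ k₂ l₂ : ℕ} (hk : k₁ ≤ k₂) (hl : l₁ - k₁ ≤ l₂ - k₂) (hkl₁ : k₁ ≤ l₁) (hkl₂ : k₂ ≤ l₂)
    {x y : ℕ → A}
    (h1 : ∀ i < k₂, x i = y i)
    (h2 : past X l₂ (shiftN^[k₂] x) = past X l₂ (shiftN^[k₂] y)) :
    (∀ i < k₁, x i = y i) ∧ past X l₁ (shiftN^[k₁] x) = past X l₁ (shiftN^[k₁] y) := by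
  refine ⟨fun i hi => h1 i (lt_of_lt_of_le hi hk), ?_⟩
  set d := k₂ - k₁ with hd
  have hx : shiftN^[k₁] x = wordCat (prefixWord (shiftN^[k₁] x) d) (shiftN^[k₂] x) := by
    have := wordCat_prefixWord (shiftN^[k₁] x) d
    rw [← Function.iterate_add_apply, show d + k₁ = k₂ by omega] at this
    exact this.symm
  have hy : shiftN^[k₁] y = wordCat (prefixWord (shiftN^[k₁] y) d) (shiftN^[k₂] y) := by
    have := wordCat_prefixWord (shiftN^[k₁] y) d
    rw [← Function.iterate_add_apply, show d + k₁ = k₂ by omega] at this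
    exact this.symm
  have hτ : prefixWord (shiftN^[k₁] x) d = prefixWord (shiftN^[k₁] y) d := by
    unfold prefixWord
    refine List.map_congr_left ?_
    intro j hj
    rw [List.mem_range] at hj
    rw [shiftN_iterate_apply, shiftN_iterate_apply]
    exact h1 (j + k₁) (by omega)
  have hpast : past X (l₁ + d) (shiftN^[k₂] x) = past X (l₁ + d) (shiftN^[k₂] y) :=
    past_mono hX (by omega) h2
  ext μ
  rw [hx, hy, ← hτ, past_wordCat, past_wordCat, prefixWord_length, hpast]

/-- The Sturmian subshift is invariant: `σ(X_α) = X_α`. -/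
lemma sturmianN_shift_image (α : ℝ) : shiftN '' sturmianN α = sturmianN α := by
  apply subset_antisymm
  · rintro y ⟨x, hx, rfl⟩
    exact sturmianN_shift_mem hx
  · have hcompact : IsCompact (sturmianN α) := isClosed_closure.isCompact
    have hcl : IsClosed (shiftN '' sturmianN α) :=
      (hcompact.image continuous_shiftN).isClosed
    have hsub : {x : ℕ → Bool | ∃ t : ℝ, x = sturmianSeqN α t} ⊆ shiftN '' sturmianN α := by
      rintro x ⟨t, rfl⟩
      refine ⟨sturmianSeqN α (t - α), subset_closure ⟨t - α, rfl⟩, ?_⟩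
      funext i
      show sturmianCode α (t - α + (↑(i + 1) : ℝ) * α) = sturmianCode α (t + (i : ℝ) * α)
      congr 1
      push_cast
      ring
    exact closure_minimal hsub hcl

/-! ### The cover of a one-sided subshift -/

/-- The equivalence relation `∼_{k,l}` on a subshift `X`:
`x ∼_{k,l} x'` iff `x_{[0,k)} = x'_{[0,k)}` and `P_l(σ^k x) = P_l(σ^k x')`. -/
def coverSetoid {A : Type*} (X : Set (ℕ → A)) (k l : ℕ) : Setoid ↥X where
  r x y := (∀ i < k, x.1 i = y.1 i) ∧
    past X l (shiftN^[k] x.1) = past X l (shiftN^[k] y.1)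
  iseqv := ⟨fun _ => ⟨fun _ _ => rfl, rfl⟩,
    fun h => ⟨fun i hi => (h.1 i hi).symm, h.2.symm⟩,
    fun h h' => ⟨fun i hi => (h.1 i hi).trans (h'.1 i hi), h.2.trans h'.2⟩⟩

/-- The index set `I = {(k,l) ∈ ℕ × ℕ : k ≤ l}`. -/
def CoverIdx : Type := {p : ℕ × ℕ // p.1 ≤ p.2}

/-- The partial order `⪯` on the index set: `(k₁,l₁) ⪯ (k₂,l₂)` iff `k₁ ≤ k₂` and
`l₁ - k₁ ≤ l₂ - k₂`. -/
def CoverIdx.le (p q : CoverIdx) : Prop :=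
  p.1.1 ≤ q.1.1 ∧ p.1.2 - p.1.1 ≤ q.1.2 - q.1.1

/-- The cover `X̃` of a one-sided subshift `X`: the projective limit of the finite
quotients `X/∼_{k,l}` over the directed set `I`, realised as the set of coherent families
of equivalence classes.  A family is coherent if any representative at an index `q` is also
a representative at every index `p ⪯ q`. -/
def SubshiftCover {A : Type*} (X : Set (ℕ → A)) : Type _ :=
  {f : (p : CoverIdx) → Quotient (coverSetoid X p.1.1 p.1.2) //
    ∀ p q : CoverIdx, CoverIdx.le p q → ∀ x : ↥X,
      f q = Quotient.mk (coverSetoid X q.1.1 q.1.2) x →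
      f p = Quotient.mk (coverSetoid X p.1.1 p.1.2) x}

instance {A : Type*} [TopologicalSpace A] (X : Set (ℕ → A)) :
    TopologicalSpace (SubshiftCover X) := by
  unfold SubshiftCover; infer_instance

/-- The factor map `π : X̃ → X` (with values in the ambient space `A^ℕ`): the `n`-th letter
of `π(xt)` is the `n`-th letter of any `(n+1, n+1)`-representative of `xt`. -/
def coverProj {A : Type*} {X : Set (ℕ → A)} (f : SubshiftCover X) : ℕ → A := fun n =>
  Quotient.lift (fun x : ↥X => x.1 n)
    (by intro a b h; obtain ⟨h1, -⟩ := h; exact h1 n (Nat.lt_succ_self n))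
    (f.1 ⟨(n + 1, n + 1), le_refl _⟩)

/-- The shift `σ̃ : X̃ → X̃` induced on the cover: the `(k,l)`-coordinate of `σ̃(xt)` is the
class of `σ(x)` for a `(k+1, l+1)`-representative `x` of `xt`. -/
def coverShift {A : Type*} {X : Set (ℕ → A)} (hX : shiftN '' X = X)
    (f : SubshiftCover X) : SubshiftCover X :=
  ⟨fun p => Quotient.lift
      (fun x : ↥X => Quotient.mk (coverSetoid X p.1.1 p.1.2)
        ⟨shiftN x.1, shiftN_mem_of_image hX x.2⟩)
      (by
        intro a b h
        obtain ⟨h1, h2⟩ := h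
        apply Quotient.sound
        constructor
        · intro i hi
          exact h1 (i + 1) (Nat.succ_lt_succ hi)
        · show past X p.1.2 (shiftN^[p.1.1] (shiftN a.1)) =
            past X p.1.2 (shiftN^[p.1.1] (shiftN b.1))
          rw [← Function.iterate_succ_apply, ← Function.iterate_succ_apply]
          exact past_mono hX (Nat.le_succ p.1.2) h2)
      (f.1 ⟨(p.1.1 + 1, p.1.2 + 1), Nat.succ_le_succ p.2⟩),
    by
      intro p q hpq y hy
      obtain ⟨x, hx⟩ := Quotient.exists_rep (f.1 ⟨(q.1.1 + 1, q.1.2 + 1), Nat.succ_le_succ q.2⟩)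
      have hq' : f.1 ⟨(p.1.1 + 1, p.1.2 + 1), Nat.succ_le_succ p.2⟩ =
          Quotient.mk (coverSetoid X (p.1.1 + 1) (p.1.2 + 1)) x := by
        refine f.2 _ ⟨(q.1.1 + 1, q.1.2 + 1), Nat.succ_le_succ q.2⟩ ?_ x hx.symm
        refine ⟨Nat.succ_le_succ hpq.1, ?_⟩
        show p.1.2 + 1 - (p.1.1 + 1) ≤ q.1.2 + 1 - (q.1.1 + 1)
        have := hpq.2; omega
      beta_reduce at hy ⊢
      rw [← hx] at hy
      rw [hq']
      obtain ⟨h1, h2⟩ := Quotient.exact hy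
      exact Quotient.sound (sim_mono hX hpq.1 hpq.2 p.2 q.2 h1 h2)⟩

/-- The section `ι : X → X̃`, sending `x` to the family of its own classes. -/
def coverIota {A : Type*} {X : Set (ℕ → A)} (hX : shiftN '' X = X) (x : ↥X) :
    SubshiftCover X :=
  ⟨fun p => Quotient.mk (coverSetoid X p.1.1 p.1.2) x, by
    intro p q hpq y hy
    obtain ⟨h1, h2⟩ := Quotient.exact hy
    exact Quotient.sound (sim_mono hX hpq.1 hpq.2 p.2 q.2 h1 h2)⟩


/-! ### Coding of orbits -/

lemma fract_add_eq_sturmianCode {α : ℝ} (hm : α ∈ Set.Ioo (0 : ℝ) 1) (t : ℝ) :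
    Int.fract (t + α) = Int.fract t + α - if sturmianCode α t then 1 else 0 := by
  have h0 := Int.fract_nonneg t
  have h1 := Int.fract_lt_one t
  obtain ⟨ha, hb⟩ := hm
  have hf := Int.floor_add_fract t
  by_cases h : 1 - α ≤ Int.fract t
  · simp only [sturmianCode, h, decide_true, if_true]
    rw [Int.fract_eq_iff]
    exact ⟨by linarith, by linarith, ⌊t⌋ + 1, by push_cast; linarith⟩
  · simp only [sturmianCode, h, decide_false, Bool.false_eq_true, if_false]
    rw [Int.fract_eq_iff]
    exact ⟨by linarith, by linarith, ⌊t⌋, by linarith⟩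

lemma fract_add_lt_iff_sturmianCode {α : ℝ} (hm : α ∈ Set.Ioo (0 : ℝ) 1) (t : ℝ) :
    Int.fract (t + α) < α ↔ sturmianCode α t = true := by
  rw [fract_add_eq_sturmianCode hm]
  have h1 := Int.fract_lt_one t
  cases sturmianCode α t
  · simp
  · simp only [if_true, iff_true]
    linarith

lemma shiftN_sturmianSeqN (α t : ℝ) : shiftN (sturmianSeqN α t) = sturmianSeqN α (t + α) := by
  funext i
  simp only [shiftN, sturmianSeqN]
  congr 1
  push_cast
  ring

lemma shiftN_iterate_sturmianSeqN (α t : ℝ) (k : ℕ) :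
    shiftN^[k] (sturmianSeqN α t) = sturmianSeqN α (t + k * α) := by
  funext i
  simp only [shiftN_iterate_apply, sturmianSeqN]
  congr 1
  push_cast
  ring

lemma sturmianSeqN_zero (α t : ℝ) : sturmianSeqN α t 0 = sturmianCode α t := by
  simp [sturmianSeqN]

lemma sturmianSeqN_succ (α t : ℝ) (i : ℕ) :
    sturmianSeqN α t (i + 1) = sturmianSeqN α (t + α) i := by
  rw [← shiftN_sturmianSeqN, shiftN]

/-- The points whose coding starts with a given word form an interval of `[0, 1)`. -/
lemma sturmianSeqN_eq_of_fract_between {α : ℝ} (hm : α ∈ Set.Ioo (0 : ℝ) 1) {n : ℕ} {s u t : ℝ}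
    (hsu : Int.fract s ≤ Int.fract u) (hut : Int.fract u ≤ Int.fract t)
    (h : ∀ i < n, sturmianSeqN α s i = sturmianSeqN α t i) :
    ∀ i < n, sturmianSeqN α u i = sturmianSeqN α t i := by
  induction n generalizing s u t with
  | zero => simp
  | succ n ih =>
    have hst : sturmianCode α s = sturmianCode α t := by
      simpa only [sturmianSeqN_zero] using h 0 n.succ_pos
    have hu : sturmianCode α u = sturmianCode α t := by
      simp only [sturmianCode, decide_eq_decide] at hst ⊢
      exact ⟨fun h => h.trans hut, fun h => (hst.2 h).trans hsu⟩
    intro i hi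
    cases i with
    | zero => simpa only [sturmianSeqN_zero] using hu
    | succ i =>
      rw [sturmianSeqN_succ, sturmianSeqN_succ]
      refine ih (s := s + α) ?_ ?_ (fun j hj => ?_) i (Nat.lt_of_succ_lt_succ hi)
      · rw [fract_add_eq_sturmianCode hm, fract_add_eq_sturmianCode hm, hst, hu]
        linarith
      · rw [fract_add_eq_sturmianCode hm, fract_add_eq_sturmianCode hm, hu]
        linarith
      · simpa only [sturmianSeqN_succ] using h (j + 1) (Nat.succ_lt_succ hj)

lemma fract_sub_fract_of_sturmianSeqN_eq {α : ℝ} (hm : α ∈ Set.Ioo (0 : ℝ) 1) {s t : ℝ}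
    (h : sturmianSeqN α s = sturmianSeqN α t) (k : ℕ) :
    Int.fract (t + k * α) - Int.fract (s + k * α) = Int.fract t - Int.fract s := by
  induction k with
  | zero => simp
  | succ k ih =>
    have hc : sturmianCode α (s + k * α) = sturmianCode α (t + k * α) := congrFun h k
    have e : ∀ r : ℝ, r + ((k + 1 : ℕ) : ℝ) * α = r + k * α + α := fun r => by push_cast; ring
    rw [e, e, fract_add_eq_sturmianCode hm, fract_add_eq_sturmianCode hm, hc, ← ih]
    ring

/-- The coding of the points of `[0, 1)` is injective for irrational `α`. -/
lemma fract_eq_of_sturmianSeqN_eq {α : ℝ} (hα : Irrational α) (hm : α ∈ Set.Ioo (0 : ℝ) 1)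
    {s t : ℝ} (h : sturmianSeqN α s = sturmianSeqN α t) : Int.fract s = Int.fract t := by
  wlog hst : Int.fract s ≤ Int.fract t generalizing s t
  · exact (this h.symm (le_of_not_ge hst)).symm
  by_contra hne
  set d := Int.fract t - Int.fract s with hd
  have hd0 : 0 < d := sub_pos.2 (lt_of_le_of_ne hst hne)
  have hk := fract_sub_fract_of_sturmianSeqN_eq hm h
  obtain ⟨n, hn⟩ := exists_nat_one_div_lt hd0
  obtain ⟨q, hq0, -, hq⟩ := Real.exists_nat_abs_mul_sub_round_le α (Nat.succ_pos n)
  set δ := (q : ℝ) * α - round ((q : ℝ) * α) with hδ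
  have hδd : |δ| < d := by
    refine hq.trans_lt (lt_of_le_of_lt ?_ hn)
    gcongr
    linarith
  have hδ0 : δ ≠ 0 := by
    intro h0
    exact (hα.natCast_mul hq0.ne').ne_int _ (sub_eq_zero.1 h0)
  obtain ⟨hl, hr⟩ := abs_lt.1 hδd
  have hs : ∀ i : ℕ, Int.fract (s + ((i * q : ℕ) : ℝ) * α) = Int.fract s + i * δ := by
    intro i
    induction i with
    | zero => simp
    | succ i ih =>
      have hs0 := Int.fract_nonneg (s + ((i * q : ℕ) : ℝ) * α)
      have ht1 := Int.fract_lt_one (t + ((i * q : ℕ) : ℝ) * α)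
      have hs0' := Int.fract_nonneg (s + (((i + 1) * q : ℕ) : ℝ) * α)
      have ht1' := Int.fract_lt_one (t + (((i + 1) * q : ℕ) : ℝ) * α)
      have hki := hk (i * q)
      have hki' := hk ((i + 1) * q)
      set a := Int.fract (s + ((i * q : ℕ) : ℝ) * α) with ha
      set b := Int.fract (s + (((i + 1) * q : ℕ) : ℝ) * α) with hb
      obtain ⟨m, hmm⟩ : ∃ m : ℤ, b - (a + δ) = m := by
        refine ⟨⌊s + ((i * q : ℕ) : ℝ) * α⌋ - ⌊s + (((i + 1) * q : ℕ) : ℝ) * α⌋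
          + round ((q : ℝ) * α), ?_⟩
        rw [ha, hb, hδ, Int.fract, Int.fract]
        push_cast
        ring
      have h1 : (-1 : ℝ) < m := by rw [← hmm]; linarith
      have h2 : (m : ℝ) < 1 := by rw [← hmm]; linarith
      have hm0 : m = 0 := by
        have h1' : -1 < m := by exact_mod_cast h1
        have h2' : m < 1 := by exact_mod_cast h2
        omega
      rw [hm0, Int.cast_zero] at hmm
      push_cast
      linarith
  obtain ⟨N, hN⟩ := exists_nat_gt (1 / |δ|)
  rw [div_lt_iff₀ (abs_pos.2 hδ0)] at hN
  have h0 := Int.fract_nonneg (s + ((N * q : ℕ) : ℝ) * α)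
  have h1 := Int.fract_lt_one (s + ((N * q : ℕ) : ℝ) * α)
  have h0' := Int.fract_nonneg s
  have h1' := Int.fract_lt_one s
  rw [hs] at h0 h1
  rcases abs_cases δ with ⟨he, -⟩ | ⟨he, -⟩ <;> rw [he] at hN <;> linarith

lemma sturmianCode_eventuallyEq_nhdsGE {α : ℝ} (t : ℝ) :
    ∀ᶠ u in nhdsWithin t (Set.Ici t), sturmianCode α u = sturmianCode α t := by
  have hfl : ∀ᶠ u in nhdsWithin t (Set.Ici t), ⌊u⌋ = ⌊t⌋ :=
    Filter.tendsto_pure.1 (tendsto_floor_right_pure_floor t)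
  by_cases h : 1 - α ≤ Int.fract t
  · filter_upwards [hfl, self_mem_nhdsWithin] with u hu htu
    simp only [sturmianCode, decide_eq_decide]
    refine iff_of_true ?_ h
    rw [Int.fract] at h ⊢
    rw [hu]
    linarith [Set.mem_Ici.1 htu]
  · have hlt : ∀ᶠ u in nhdsWithin t (Set.Ici t), u < 1 - α + ⌊t⌋ :=
      mem_nhdsWithin_of_mem_nhds (Iio_mem_nhds (by rw [Int.fract] at h; linarith))
    filter_upwards [hfl, hlt] with u hu hlt
    simp only [sturmianCode, decide_eq_decide]
    refine iff_of_false ?_ h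
    rw [Int.fract, hu]
    linarith

lemma sturmianCode_eventuallyEq_nhds {α t : ℝ} (h0 : Int.fract t ≠ 0)
    (h1 : Int.fract t ≠ 1 - α) :
    ∀ᶠ u in nhds t, sturmianCode α u = sturmianCode α t := by
  have hpos := lt_of_le_of_ne (Int.fract_nonneg t) h0.symm
  have hlt := Int.fract_lt_one t
  rw [Int.fract] at hpos hlt
  have hfl : ∀ᶠ u in nhds t, ⌊u⌋ = ⌊t⌋ := by
    filter_upwards [Ioo_mem_nhds (a := (⌊t⌋ : ℝ)) (b := ⌊t⌋ + 1) (by linarith) (by linarith)]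
      with u hu
    exact Int.floor_eq_iff.2 ⟨hu.1.le, hu.2⟩
  rcases lt_or_gt_of_ne h1 with h | h
  · have hev : ∀ᶠ u in nhds t, u < 1 - α + ⌊t⌋ :=
      Iio_mem_nhds (by rw [Int.fract] at h; linarith)
    filter_upwards [hfl, hev] with u hu hlt
    simp only [sturmianCode, decide_eq_decide]
    refine iff_of_false ?_ h.not_ge
    rw [Int.fract, hu]
    linarith
  · have hev : ∀ᶠ u in nhds t, 1 - α + ⌊t⌋ < u :=
      Ioi_mem_nhds (by rw [Int.fract] at h; linarith)
    filter_upwards [hfl, hev] with u hu hlt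
    simp only [sturmianCode, decide_eq_decide]
    refine iff_of_true ?_ h.le
    rw [Int.fract, hu]
    linarith

lemma sturmianSeqN_eventuallyEq_nhdsGE {α : ℝ} (t : ℝ) (n : ℕ) :
    ∀ᶠ u in nhdsWithin t (Set.Ici t), ∀ i < n, sturmianSeqN α u i = sturmianSeqN α t i := by
  have h : ∀ i : ℕ, ∀ᶠ u in nhdsWithin t (Set.Ici t),
      sturmianSeqN α u i = sturmianSeqN α t i := by
    intro i
    have ht : Filter.Tendsto (fun u : ℝ => u + i * α) (nhdsWithin t (Set.Ici t))
        (nhdsWithin (t + i * α) (Set.Ici (t + i * α))) :=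
      (Continuous.continuousWithinAt (by fun_prop)).tendsto_nhdsWithin
        fun u hu => add_le_add_left (Set.mem_Ici.1 hu) _
    exact ht.eventually (sturmianCode_eventuallyEq_nhdsGE _)
  exact (Filter.eventually_all_finite (Set.finite_lt_nat n)).2 fun i _ => h i

/-! ### Preimages and pasts in the Sturmian subshift -/

lemma mem_closure_iff_forall_exists_agree {A : Type*} [TopologicalSpace A] [DiscreteTopology A]
    {S : Set (ℕ → A)} {x : ℕ → A} :
    x ∈ closure S ↔ ∀ n : ℕ, ∃ y ∈ S, ∀ i < n, y i = x i := by
  constructor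
  · intro hx n
    have ho : {y : ℕ → A | ∀ i < n, y i = x i} ∈ nhds x :=
      (Filter.eventually_all_finite (Set.finite_lt_nat n)).2 fun i _ =>
        (continuous_apply i).continuousAt.eventually
          (show ∀ᶠ a in nhds (x i), a = x i by simp [nhds_discrete])
    obtain ⟨y, hy, hyS⟩ := mem_closure_iff_nhds.1 hx _ ho
    exact ⟨y, hyS, hy⟩
  · intro h
    choose y hyS hy using h
    refine mem_closure_of_tendsto (b := Filter.atTop) (f := y) ?_ (Filter.Eventually.of_forall hyS)
    refine tendsto_pi_nhds.2 fun i => tendsto_const_nhds.congr' ?_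
    filter_upwards [Filter.eventually_gt_atTop i] with n hn using (hy n i hn).symm

lemma mem_sturmianN_iff {α : ℝ} {x : ℕ → Bool} :
    x ∈ sturmianN α ↔ ∀ n : ℕ, ∃ t : ℝ, ∀ i < n, sturmianSeqN α t i = x i := by
  rw [sturmianN, mem_closure_iff_forall_exists_agree]
  simp

lemma sturmianSeqN_mem (α t : ℝ) : sturmianSeqN α t ∈ sturmianN α := subset_closure ⟨t, rfl⟩

lemma sturmianBranch_mem (α : ℝ) : sturmianBranch α ∈ sturmianN α := sturmianSeqN_mem α α

lemma shiftN_iterate_mem_sturmianN {α : ℝ} {x : ℕ → Bool} (hx : x ∈ sturmianN α) (k : ℕ) :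
    shiftN^[k] x ∈ sturmianN α :=
  shiftN_iterate_mem_of_image (sturmianN_shift_image α) hx k

/-- Only the branch point has two preimages. -/
lemma eq_sturmianBranch_of_consSeq_mem {α : ℝ} (hm : α ∈ Set.Ioo (0 : ℝ) 1) {x : ℕ → Bool}
    (h0 : consSeq false x ∈ sturmianN α) (h1 : consSeq true x ∈ sturmianN α) :
    x = sturmianBranch α := by
  funext n
  obtain ⟨t, ht⟩ := mem_sturmianN_iff.1 h0 (n + 2)
  obtain ⟨s, hs⟩ := mem_sturmianN_iff.1 h1 (n + 2)
  have hfα : Int.fract α = α := Int.fract_eq_self.2 ⟨hm.1.le, hm.2⟩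
  have ht0 : sturmianCode α t = false := by
    rw [← sturmianSeqN_zero, ht 0 (by omega)]; rfl
  have hs0 : sturmianCode α s = true := by
    rw [← sturmianSeqN_zero, hs 0 (by omega)]; rfl
  have ht' : ∀ i < n + 1, sturmianSeqN α (t + α) i = x i := fun i hi => by
    rw [← sturmianSeqN_succ, ht _ (by omega)]; simp [consSeq]
  have hs' : ∀ i < n + 1, sturmianSeqN α (s + α) i = x i := fun i hi => by
    rw [← sturmianSeqN_succ, hs _ (by omega)]; simp [consSeq]
  have hsα : Int.fract (s + α) ≤ Int.fract α := by
    rw [hfα]; exact ((fract_add_lt_iff_sturmianCode hm s).2 hs0).le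
  have htα : Int.fract α ≤ Int.fract (t + α) := by
    rw [hfα, ← not_lt, fract_add_lt_iff_sturmianCode hm, ht0]; simp
  have := sturmianSeqN_eq_of_fract_between hm hsα htα
    (fun i hi => (hs' i hi).trans (ht' i hi).symm) n n.lt_succ_self
  rw [← ht' n n.lt_succ_self, ← this, sturmianBranch]

lemma consSeq_false_sturmianBranch_mem {α : ℝ} (hm : α ∈ Set.Ioo (0 : ℝ) 1) :
    consSeq false (sturmianBranch α) ∈ sturmianN α := by
  have h : consSeq (sturmianSeqN α 0 0) (shiftN (sturmianSeqN α 0)) ∈ sturmianN α := by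
    rw [consSeq_shiftN]; exact sturmianSeqN_mem α 0
  have h0 : sturmianSeqN α 0 0 = false := by
    have := hm.2
    simpa [sturmianSeqN_zero, sturmianCode] using this
  rwa [h0, shiftN_sturmianSeqN, zero_add] at h

lemma consSeq_true_sturmianBranch_mem {α : ℝ} (hα : Irrational α) (hm : α ∈ Set.Ioo (0 : ℝ) 1) :
    consSeq true (sturmianBranch α) ∈ sturmianN α := by
  rw [mem_sturmianN_iff]
  intro n
  have hcont : ∀ i : ℕ, ∀ᶠ u in nhds (0 : ℝ),
      sturmianSeqN α (u + α) i = sturmianBranch α i := by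
    intro i
    have h0 : Int.fract (α + i * α) ≠ 0 := by
      intro h
      obtain ⟨m, hmm⟩ := Int.fract_eq_zero_iff.1 h
      refine (hα.natCast_mul i.succ_ne_zero).ne_int m ?_
      push_cast; linarith
    have h1 : Int.fract (α + i * α) ≠ 1 - α := by
      intro h
      obtain ⟨-, -, m, hmm⟩ := Int.fract_eq_iff.1 h
      refine (hα.natCast_mul (i + 1).succ_ne_zero).ne_int (m + 1) ?_
      push_cast; linarith
    have ht : Filter.Tendsto (fun u : ℝ => u + α + i * α) (nhds 0) (nhds (α + i * α)) := by
      have : Continuous (fun u : ℝ => u + α + i * α) := by fun_prop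
      simpa using this.tendsto 0
    exact ht.eventually (sturmianCode_eventuallyEq_nhds h0 h1)
  have hall : ∀ᶠ u in nhds (0 : ℝ), ∀ i < n, sturmianSeqN α (u + α) i = sturmianBranch α i :=
    (Filter.eventually_all_finite (Set.finite_lt_nat n)).2 fun i _ => hcont i
  obtain ⟨u, hu, hu1, hu0⟩ := ((hall.filter_mono nhdsWithin_le_nhds).and
    (Ioo_mem_nhdsLT (neg_neg_of_pos hm.1))).exists
  refine ⟨u, fun i hi => ?_⟩
  cases i with
  | zero =>
    have hf : Int.fract u = u + 1 :=
      Int.fract_eq_iff.2 ⟨by linarith [hm.2], by linarith, -1, by push_cast; ring⟩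
    rw [sturmianSeqN_zero]
    simp only [sturmianCode, hf, consSeq, if_true, decide_eq_true_eq]
    linarith
  | succ i =>
    rw [sturmianSeqN_succ, hu i (by omega)]
    simp [consSeq]

/-- The forward orbit of the branch point is infinite. -/
lemma shiftN_iterate_sturmianBranch_injective {α : ℝ} (hα : Irrational α)
    (hm : α ∈ Set.Ioo (0 : ℝ) 1) :
    Function.Injective fun k : ℕ => shiftN^[k] (sturmianBranch α) := by
  intro j k h
  simp only [sturmianBranch, shiftN_iterate_sturmianSeqN] at h
  obtain ⟨m, hmm⟩ := Int.fract_eq_fract.1 (fract_eq_of_sturmianSeqN_eq hα hm h)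
  by_contra hne
  refine (hα.intCast_mul (m := (j : ℤ) - k) (by omega)).ne_int m ?_
  push_cast; linarith

lemma eq_of_shiftN_iterate_eq {α : ℝ} (hm : α ∈ Set.Ioo (0 : ℝ) 1) {l : ℕ} {z w : ℕ → Bool}
    (hz : z ∈ sturmianN α) (hw : w ∈ sturmianN α) (h : shiftN^[l] z = shiftN^[l] w)
    (hne : ∀ j < l, shiftN^[l] z ≠ shiftN^[j] (sturmianBranch α)) : z = w := by
  induction l generalizing z w with
  | zero => exact h
  | succ l ih =>
    have hs : shiftN z = shiftN w :=
      ih (sturmianN_shift_mem hz) (sturmianN_shift_mem hw) h fun j hj => hne j (by omega)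
    rw [← consSeq_shiftN z] at hz
    rw [← consSeq_shiftN w, ← hs] at hw
    by_cases h0 : z 0 = w 0
    · rw [← consSeq_shiftN z, ← consSeq_shiftN w, hs, h0]
    · exfalso
      refine hne l l.lt_succ_self ?_
      rw [Function.iterate_succ_apply]
      congr 1
      cases hz0 : z 0 <;> cases hw0 : w 0 <;> simp only [hz0, hw0] at hz hw h0
      · exact absurd trivial h0
      · exact eq_sturmianBranch_of_consSeq_mem hm hz hw
      · exact eq_sturmianBranch_of_consSeq_mem hm hw hz
      · exact absurd trivial h0

lemma wordCat_injective_of_length_eq {A : Type*} {μ ν : List A} {x : ℕ → A}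
    (hlen : μ.length = ν.length) (h : wordCat μ x = wordCat ν x) : μ = ν := by
  induction μ generalizing ν with
  | nil => exact (List.length_eq_zero_iff.1 hlen.symm).symm
  | cons a μ ih =>
    cases ν with
    | nil => simp at hlen
    | cons b ν =>
      change consSeq a (wordCat μ x) = consSeq b (wordCat ν x) at h
      have hab : a = b := by simpa [consSeq] using congrFun h 0
      have ht := congrArg shiftN h
      rw [shiftN_consSeq, shiftN_consSeq] at ht
      rw [hab, ih (by simpa using hlen) ht]

lemma prefixWord_mem_past {A : Type*} {X : Set (ℕ → A)} {z : ℕ → A} (hz : z ∈ X) (l : ℕ) :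
    prefixWord z l ∈ past X l (shiftN^[l] z) :=
  ⟨prefixWord_length z l, by rwa [wordCat_prefixWord]⟩

lemma past_shiftN_iterate_eq_singleton {α : ℝ} (hm : α ∈ Set.Ioo (0 : ℝ) 1) {l : ℕ}
    {z : ℕ → Bool} (hz : z ∈ sturmianN α)
    (hne : ∀ j < l, shiftN^[l] z ≠ shiftN^[j] (sturmianBranch α)) :
    past (sturmianN α) l (shiftN^[l] z) = {prefixWord z l} := by
  refine subset_antisymm ?_ (Set.singleton_subset_iff.2 (prefixWord_mem_past hz l))
  rintro μ ⟨hlen, hμ⟩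
  have h : shiftN^[l] (wordCat μ (shiftN^[l] z)) = shiftN^[l] z := by
    conv_lhs => rw [← hlen]
    rw [shiftN_iterate_wordCat, hlen]
  have hzμ := eq_of_shiftN_iterate_eq hm hz hμ h.symm hne
  refine wordCat_injective_of_length_eq (x := shiftN^[l] z) ?_ ?_
  · rw [hlen, prefixWord_length]
  · rw [wordCat_prefixWord, ← hzμ]

/-- Points of `X_α` with a given prefix of length `l` have infinitely many `l`-fold shifts. -/
lemma exists_agree_shiftN_iterate_notMem {α : ℝ} (hα : Irrational α)
    (hm : α ∈ Set.Ioo (0 : ℝ) 1) {z : ℕ → Bool} (hz : z ∈ sturmianN α) (l : ℕ)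
    {F : Set (ℕ → Bool)} (hF : F.Finite) :
    ∃ w ∈ sturmianN α, (∀ i < l, w i = z i) ∧ shiftN^[l] w ∉ F := by
  obtain ⟨t, ht⟩ := mem_sturmianN_iff.1 hz l
  obtain ⟨b, hb, hsub⟩ := mem_nhdsGE_iff_exists_Ico_subset.1
    (sturmianSeqN_eventuallyEq_nhdsGE (α := α) t l)
  have htb : t < min b (t + 1) := lt_min hb (lt_add_one t)
  have hinj : Set.InjOn (fun u : ℝ => shiftN^[l] (sturmianSeqN α u))
      (Set.Ico t (min b (t + 1))) := by
    intro u hu v hv h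
    simp only [shiftN_iterate_sturmianSeqN] at h
    obtain ⟨m, hmm⟩ := Int.fract_eq_fract.1 (fract_eq_of_sturmianSeqN_eq hα hm h)
    have hu1 := hu.2.trans_le (min_le_right _ _)
    have hv1 := hv.2.trans_le (min_le_right _ _)
    have h1 : (-1 : ℝ) < m := by linarith [hu.1]
    have h2 : (m : ℝ) < 1 := by linarith [hv.1]
    have hm0 : m = 0 := by
      have h1' : -1 < m := by exact_mod_cast h1
      have h2' : m < 1 := by exact_mod_cast h2
      omega
    rw [hm0, Int.cast_zero] at hmm
    linarith
  obtain ⟨-, ⟨u, hu, rfl⟩, huF⟩ :=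
    (((Set.Ico_infinite htb).image hinj).sdiff hF).nonempty
  exact ⟨_, sturmianSeqN_mem α u,
    fun i hi => (hsub ⟨hu.1, hu.2.trans_le (min_le_left _ _)⟩ i hi).trans (ht i hi), huF⟩

lemma cons_prefixWord_sturmianBranch_mem_past {α : ℝ} (hα : Irrational α)
    (hm : α ∈ Set.Ioo (0 : ℝ) 1) (k : ℕ) (a : Bool) :
    a :: prefixWord (sturmianBranch α) k ∈
      past (sturmianN α) (k + 1) (shiftN^[k] (sturmianBranch α)) := by
  refine ⟨by simp [prefixWord_length], ?_⟩
  change consSeq a (wordCat _ _) ∈ _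
  rw [wordCat_prefixWord]
  cases a
  · exact consSeq_false_sturmianBranch_mem hm
  · exact consSeq_true_sturmianBranch_mem hα hm

lemma past_shiftN_iterate_sturmianBranch {α : ℝ} (hα : Irrational α)
    (hm : α ∈ Set.Ioo (0 : ℝ) 1) (k : ℕ) :
    past (sturmianN α) (k + 1) (shiftN^[k] (sturmianBranch α)) =
      {false :: prefixWord (sturmianBranch α) k, true :: prefixWord (sturmianBranch α) k} := by
  refine subset_antisymm ?_ (Set.insert_subset_iff.2
    ⟨cons_prefixWord_sturmianBranch_mem_past hα hm k false, Set.singleton_subset_iff.2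
      (cons_prefixWord_sturmianBranch_mem_past hα hm k true)⟩)
  rintro (_ | ⟨a, μ⟩) ⟨hlen, hμ⟩
  · simp at hlen
  · have hμ' : wordCat μ (shiftN^[k] (sturmianBranch α)) ∈ sturmianN α := by
      have := sturmianN_shift_mem hμ
      change shiftN (consSeq a (wordCat μ _)) ∈ _ at this
      rwa [shiftN_consSeq] at this
    have hmem : μ ∈ past (sturmianN α) k (shiftN^[k] (sturmianBranch α)) :=
      ⟨by simpa using hlen, hμ'⟩
    rw [past_shiftN_iterate_eq_singleton hm (sturmianBranch_mem α) fun j hj h =>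
      hj.ne' (shiftN_iterate_sturmianBranch_injective hα hm h)] at hmem
    rw [Set.mem_singleton_iff.1 hmem]
    cases a <;> simp

lemma isolatedInPast_shiftN_iterate_sturmianBranch {α : ℝ} (hα : Irrational α)
    (hm : α ∈ Set.Ioo (0 : ℝ) 1) (k : ℕ) :
    IsolatedInPast (sturmianN α) (k + 1) (shiftN^[k] (sturmianBranch α)) := by
  intro y _ h
  have hmem : ∀ a : Bool,
      consSeq a (wordCat (prefixWord (sturmianBranch α) k) y) ∈ sturmianN α := by
    intro a
    have := cons_prefixWord_sturmianBranch_mem_past hα hm k a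
    rw [← h] at this
    exact this.2
  rw [← eq_sturmianBranch_of_consSeq_mem hm (hmem false) (hmem true)]
  conv_lhs => rw [← shiftN_iterate_wordCat (prefixWord (sturmianBranch α) k) y]
  rw [prefixWord_length]

/-- (1) For every `k`, the point `σ_α^k(ω_α)` is isolated in `(k+1)`-past
equivalence, with `(k+1)`-past `{0·ω_{[0,k)}, 1·ω_{[0,k)}}`; (2) `x ∈ X_α` is isolated in
`l`-past equivalence for some `l` iff `x ∈ orb⁺_α(ω_α)`; (3) `x` has a unique past iff
`x ∉ orb⁺_α(ω_α)`. -/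
theorem sturmian_isolated_in_past (α : ℝ) (hα : Irrational α)
    (hm : α ∈ Set.Ioo (0 : ℝ) 1) :
    (∀ k : ℕ,
      IsolatedInPast (sturmianN α) (k + 1) (shiftN^[k] (sturmianBranch α)) ∧
      past (sturmianN α) (k + 1) (shiftN^[k] (sturmianBranch α))
        = {false :: (List.range k).map (sturmianBranch α),
           true :: (List.range k).map (sturmianBranch α)}) ∧
    (∀ x ∈ sturmianN α,
      (∃ l : ℕ, IsolatedInPast (sturmianN α) l x)
        ↔ x ∈ sturmianOrbPlus α (sturmianBranch α)) ∧
    (∀ x ∈ sturmianN α,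
      (∀ k : ℕ, ∃ y : ℕ → Bool, {z : ℕ → Bool | z ∈ sturmianN α ∧ shiftN^[k] z = x} = {y})
        ↔ x ∉ sturmianOrbPlus α (sturmianBranch α)) := by
  refine ⟨fun k => ⟨isolatedInPast_shiftN_iterate_sturmianBranch hα hm k,
    past_shiftN_iterate_sturmianBranch hα hm k⟩, fun x hx => ⟨?_, ?_⟩, fun x hx => ⟨?_, ?_⟩⟩
  · rintro ⟨l, hl⟩
    by_contra hx'
    obtain ⟨μ, hlen, hμ⟩ := exists_word_extension (sturmianN_shift_image α) hx l
    obtain ⟨w, hw, hwz, hwF⟩ := exists_agree_shiftN_iterate_notMem hα hm hμ l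
      (((Set.finite_lt_nat l).image fun j => shiftN^[j] (sturmianBranch α)).insert x)
    have hxz : shiftN^[l] (wordCat μ x) = x := by rw [← hlen, shiftN_iterate_wordCat]
    have hpx := past_shiftN_iterate_eq_singleton hm hμ (l := l) fun j _ h =>
      hx' ⟨j, hxz.symm.trans h⟩
    have hpw := past_shiftN_iterate_eq_singleton hm hw (l := l) fun j hj h =>
      hwF (Set.mem_insert_of_mem _ ⟨j, hj, h.symm⟩)
    have hpre : prefixWord w l = prefixWord (wordCat μ x) l :=
      List.map_congr_left fun i hi => hwz i (List.mem_range.1 hi)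
    rw [hxz] at hpx
    refine hwF (Set.mem_insert_iff.2 (Or.inl ?_))
    exact hl _ (shiftN_iterate_mem_sturmianN hw l) (by rw [hpw, hpx, hpre])
  · rintro ⟨k, rfl⟩
    exact ⟨k + 1, isolatedInPast_shiftN_iterate_sturmianBranch hα hm k⟩
  · rintro h ⟨k, rfl⟩
    obtain ⟨y, hy⟩ := h (k + 1)
    have key : ∀ a : Bool, consSeq a (sturmianBranch α) ∈ sturmianN α →
        consSeq a (sturmianBranch α) = y := by
      intro a ha
      rw [← Set.mem_singleton_iff, ← hy]
      exact ⟨ha, by rw [Function.iterate_succ_apply, shiftN_consSeq]⟩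
    have heq := (key false (consSeq_false_sturmianBranch_mem hm)).trans
      (key true (consSeq_true_sturmianBranch_mem hα hm)).symm
    simpa [consSeq] using congrFun heq 0
  · intro hx' k
    obtain ⟨μ, hlen, hμ⟩ := exists_word_extension (sturmianN_shift_image α) hx k
    have hxz : shiftN^[k] (wordCat μ x) = x := by rw [← hlen, shiftN_iterate_wordCat]
    refine ⟨wordCat μ x, Set.eq_singleton_iff_unique_mem.2 ⟨⟨hμ, hxz⟩, ?_⟩⟩
    rintro z ⟨hz, hzx⟩
    exact eq_of_shiftN_iterate_eq hm hz hμ (hzx.trans hxz.symm) fun j _ h =>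
      hx' ⟨j, hzx.symm.trans h⟩

end
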